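/- Let v be a complete Llull matrix on a finite set A of N elements, with projected scores v^π and rank-like rates R_x = N − Σ_{y ≠ x} v^π_{xy}. Then: (a) if x precedes y in an admissible order ξ, then R_x ≤ R_y; (b) R_x = R_y if and only if v^π_{xy} = v^π_{yx}; (c) R_x < R_y if and only if v^π_{xy} > v^π_{yx}; (d) if v^π_{xy} > v^π_{yx}, then x precedes y in every admissible order ξ. -/

import Mathlib

/-! Common definitions: valued relations, indirect scores, admissible orders,
projected margins/scores, rank-like rates (Camps–Mora–Saumell CLC method). -/

variable {A : Type*} [Fintype A] [DecidableEq A]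

/-- The score of a chain `x₀ :: x₁ :: ... :: xₙ`: the minimum of `v xᵢ xᵢ₊₁`
over its links (value `1` for chains with no link, which we never use). -/
noncomputable def linkScore (v : A → A → ℝ) : List A → ℝ
  | [] => 1
  | [_] => 1
  | [a, b] => v a b
  | a :: b :: c :: l => min (v a b) (linkScore v (b :: c :: l))

/-- The indirect score `v*_{xy}`: the supremum (= maximum) of the scores of all
paths from `x` to `y` (with at least one link, consecutive elements distinct). -/
noncomputable def istar (v : A → A → ℝ) (x y : A) : ℝ :=
  sSup { s : ℝ | ∃ l : List A, List.Chain' (· ≠ ·) (x :: (l ++ [y])) ∧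
      s = linkScore v (x :: (l ++ [y])) }

/-- `ξ` is a strict total order: irreflexive, transitive, total. -/
def StrictTotal (ξ : A → A → Prop) : Prop :=
  (∀ x, ¬ ξ x x) ∧ (∀ x y z, ξ x y → ξ y z → ξ x z) ∧ (∀ x y, x ≠ y → ξ x y ∨ ξ y x)

/-- `ξ` is admissible for `v`: `v*_{xy} > v*_{yx}` implies `x` precedes `y`. -/
def Adm (v : A → A → ℝ) (ξ : A → A → Prop) : Prop :=
  ∀ x y, istar v x y > istar v y x → ξ x y

/-- Intermediate projected margin `m^σ_{xy}` (for `x` preceding `y` in `ξ`):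
the infimum (= minimum) of the indirect margins `m*_{pq}` over `p ⪯ x`, `y ⪯ q`. -/
noncomputable def msigma (v : A → A → ℝ) (ξ : A → A → Prop) (x y : A) : ℝ :=
  sInf { s : ℝ | ∃ p q, (ξ p x ∨ p = x) ∧ (ξ y q ∨ q = y) ∧
      s = istar v p q - istar v q p }

/-- `q` is the immediate successor of `p` in `ξ`. -/
def ImmSucc (ξ : A → A → Prop) (p q : A) : Prop :=
  ξ p q ∧ ∀ z, ¬ (ξ p z ∧ ξ z q)

/-- Projected margin (for `x` preceding `y` in `ξ`): the supremum (= maximum) of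
`m^σ_{p p'}` over `x ⪯ p ≺ y`, `p'` the immediate successor of `p`. -/
noncomputable def mpiAux (v : A → A → ℝ) (ξ : A → A → Prop) (x y : A) : ℝ :=
  sSup { s : ℝ | ∃ p q, (ξ x p ∨ p = x) ∧ ξ p y ∧ ImmSucc ξ p q ∧
      s = msigma v ξ p q }

open Classical in
/-- Projected margins `m^π`, extended antisymmetrically. -/
noncomputable def mpi (v : A → A → ℝ) (ξ : A → A → Prop) (x y : A) : ℝ :=
  if ξ x y then mpiAux v ξ x y else - mpiAux v ξ y x

/-- Projected scores `v^π_{xy} = (1 + m^π_{xy})/2`. -/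
noncomputable def vpi (v : A → A → ℝ) (ξ : A → A → Prop) (x y : A) : ℝ :=
  (1 + mpi v ξ x y) / 2

/-- Rank-like rate `R_x = N - ∑_{y ≠ x} v^π_{xy}`. -/
noncomputable def rlr (v : A → A → ℝ) (ξ : A → A → Prop) (x : A) : ℝ :=
  (Fintype.card A : ℝ) - ∑ y ∈ Finset.univ.erase x, vpi v ξ x y

/-- `v` is a complete Llull matrix: scores of distinct pairs lie in `[0,1]`
and satisfy `v_{xy} + v_{yx} = 1`. -/
def Llull (v : A → A → ℝ) : Prop :=
  ∀ x y : A, x ≠ y → 0 ≤ v x y ∧ v x y ≤ 1 ∧ v x y + v y x = 1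

theorem StrictTotal.asymm {A : Type*} {ξ : A → A → Prop} (hξ : StrictTotal ξ)
    {x y : A} (h : ξ x y) : ¬ ξ y x :=
  fun h' => hξ.1 x (hξ.2.1 x y x h h')

theorem StrictTotal.ne {A : Type*} {ξ : A → A → Prop} (hξ : StrictTotal ξ)
    {x y : A} (h : ξ x y) : x ≠ y := by
  rintro rfl
  exact hξ.1 x h

/-- The immediate successor of a predecessor of `y` weakly precedes `y`. -/
theorem ImmSucc.le_of_lt {A : Type*} {ξ : A → A → Prop} (hξ : StrictTotal ξ) {p q y : A}
    (h : ImmSucc ξ p q) (hy : ξ p y) : ξ q y ∨ y = q := by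
  by_cases hq : y = q
  · exact Or.inr hq
  · exact Or.inl ((hξ.2.2 y q hq).resolve_left fun hyq => h.2 y ⟨hy, hyq⟩)

theorem msigma_le {A : Type*} [Finite A] (v : A → A → ℝ) (ξ : A → A → Prop) {x y p q : A}
    (hp : ξ p x ∨ p = x) (hq : ξ y q ∨ q = y) :
    msigma v ξ x y ≤ istar v p q - istar v q p := by
  refine csInf_le (Set.Finite.bddBelow ?_) ⟨p, q, hp, hq, rfl⟩
  refine (Set.finite_range fun r : A × A => istar v r.1 r.2 - istar v r.2 r.1).subset ?_
  rintro s ⟨a, b, -, -, rfl⟩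
  exact ⟨(a, b), rfl⟩

theorem msigma_nonneg {A : Type*} {v : A → A → ℝ} {ξ : A → A → Prop} (hξ : StrictTotal ξ)
    (hadm : Adm v ξ) {x y : A} (hxy : ξ x y) : 0 ≤ msigma v ξ x y := by
  refine Real.sInf_nonneg ?_
  rintro s ⟨p, q, hp, hq, rfl⟩
  have hpy : ξ p y := hp.elim (fun h => hξ.2.1 _ _ _ h hxy) (fun h => h ▸ hxy)
  have hpq : ξ p q := hq.elim (fun h => hξ.2.1 _ _ _ hpy h) (fun h => h ▸ hpy)
  have hle := not_lt.1 fun h => hξ.asymm hpq (hadm q p h)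
  linarith

theorem msigma_le_mpiAux {A : Type*} [Finite A] (v : A → A → ℝ) (ξ : A → A → Prop) {x y p q : A}
    (hp : ξ x p ∨ p = x) (hy : ξ p y) (hpq : ImmSucc ξ p q) :
    msigma v ξ p q ≤ mpiAux v ξ x y := by
  refine le_csSup (Set.Finite.bddAbove ?_) ⟨p, q, hp, hy, hpq, rfl⟩
  refine (Set.finite_range fun r : A × A => msigma v ξ r.1 r.2).subset ?_
  rintro s ⟨a, b, -, -, -, rfl⟩
  exact ⟨(a, b), rfl⟩

theorem mpiAux_nonneg {A : Type*} {v : A → A → ℝ} {ξ : A → A → Prop} (hξ : StrictTotal ξ)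
    (hadm : Adm v ξ) (x y : A) : 0 ≤ mpiAux v ξ x y := by
  refine Real.sSup_nonneg ?_
  rintro s ⟨p, q, -, -, hpq, rfl⟩
  exact msigma_nonneg hξ hadm hpq.1

theorem mpiAux_eq_max {A : Type*} [Finite A] {v : A → A → ℝ} {ξ : A → A → Prop} (hξ : StrictTotal ξ)
    (hadm : Adm v ξ) {x y z : A} (hxy : ξ x y) (hyz : ξ y z) :
    mpiAux v ξ x z = max (mpiAux v ξ x y) (mpiAux v ξ y z) := by
  refine le_antisymm (Real.sSup_le ?_ (le_max_of_le_left (mpiAux_nonneg hξ hadm x y)))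
    (max_le (Real.sSup_le ?_ (mpiAux_nonneg hξ hadm x z))
      (Real.sSup_le ?_ (mpiAux_nonneg hξ hadm x z)))
  · rintro s ⟨p, q, hp, hpz, hpq, rfl⟩
    by_cases hpy : ξ p y
    · exact le_max_of_le_left (msigma_le_mpiAux v ξ hp hpy hpq)
    · refine le_max_of_le_right (msigma_le_mpiAux v ξ ?_ hpz hpq)
      by_cases h : p = y
      · exact Or.inr h
      · exact Or.inl ((hξ.2.2 p y h).resolve_left hpy)
  · rintro s ⟨p, q, hp, hpy, hpq, rfl⟩
    exact msigma_le_mpiAux v ξ hp (hξ.2.1 _ _ _ hpy hyz) hpq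
  · rintro s ⟨p, q, hp, hpz, hpq, rfl⟩
    refine msigma_le_mpiAux v ξ (Or.inl ?_) hpz hpq
    exact hp.elim (fun h => hξ.2.1 _ _ _ hxy h) (fun h => h ▸ hxy)

/-- A positive projected margin forces a positive indirect margin. -/
theorem istar_lt_of_mpiAux_pos {A : Type*} [Finite A] {v : A → A → ℝ} {ξ : A → A → Prop} (hξ : StrictTotal ξ)
    {x y : A} (h : 0 < mpiAux v ξ x y) : istar v y x < istar v x y := by
  by_contra! hle
  refine h.not_ge (Real.sSup_nonpos ?_)
  rintro s ⟨p, q, hp, hpy, hpq, rfl⟩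
  have := msigma_le v ξ (hp.imp_right Eq.symm) (hpq.le_of_lt hξ hpy)
  linarith

theorem mpi_of_lt {A : Type*} {v : A → A → ℝ} {ξ : A → A → Prop} {x y : A} (h : ξ x y) :
    mpi v ξ x y = mpiAux v ξ x y :=
  if_pos h

theorem mpi_of_gt {A : Type*} {v : A → A → ℝ} {ξ : A → A → Prop} (hξ : StrictTotal ξ) {x y : A}
    (h : ξ x y) : mpi v ξ y x = - mpiAux v ξ x y :=
  if_neg (hξ.asymm h)

theorem vpi_sub_vpi_swap {A : Type*} {v : A → A → ℝ} {ξ : A → A → Prop} (hξ : StrictTotal ξ) {x y : A}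
    (h : ξ x y) : vpi v ξ x y - vpi v ξ y x = mpiAux v ξ x y := by
  rw [vpi, vpi, mpi_of_lt h, mpi_of_gt hξ h]
  ring

/-- If `x` precedes `y`, row `x` of the projected scores dominates row `y`. -/
theorem vpi_le_vpi {A : Type*} [Finite A] {v : A → A → ℝ} {ξ : A → A → Prop} (hξ : StrictTotal ξ)
    (hadm : Adm v ξ) {x y z : A} (hxy : ξ x y) (hzx : z ≠ x) (hzy : z ≠ y) :
    vpi v ξ y z ≤ vpi v ξ x z := by
  have key : mpi v ξ y z ≤ mpi v ξ x z := by
    rcases hξ.2.2 z x hzx with h | h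
    · rw [mpi_of_gt hξ h, mpi_of_gt hξ (hξ.2.1 _ _ _ h hxy), mpiAux_eq_max hξ hadm h hxy]
      exact neg_le_neg (le_max_left _ _)
    rcases hξ.2.2 z y hzy with h' | h'
    · rw [mpi_of_lt h, mpi_of_gt hξ h']
      linarith [mpiAux_nonneg hξ hadm x z, mpiAux_nonneg hξ hadm z y]
    · rw [mpi_of_lt h, mpi_of_lt h', mpiAux_eq_max hξ hadm hxy h']
      exact le_max_right _ _
  unfold vpi
  linarith

/-- Elements with zero projected margin have the same projected scores against all others. -/
theorem vpi_eq_vpi {A : Type*} [Finite A] {v : A → A → ℝ} {ξ : A → A → Prop} (hξ : StrictTotal ξ)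
    (hadm : Adm v ξ) {x y z : A} (hxy : ξ x y) (h0 : mpiAux v ξ x y = 0)
    (hzx : z ≠ x) (hzy : z ≠ y) : vpi v ξ y z = vpi v ξ x z := by
  have key : mpi v ξ y z = mpi v ξ x z := by
    rcases hξ.2.2 z x hzx with h | h
    · rw [mpi_of_gt hξ h, mpi_of_gt hξ (hξ.2.1 _ _ _ h hxy), mpiAux_eq_max hξ hadm h hxy, h0,
        max_eq_left (mpiAux_nonneg hξ hadm z x)]
    rcases hξ.2.2 z y hzy with h' | h'
    · rw [mpiAux_eq_max hξ hadm h h'] at h0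
      rw [mpi_of_lt h, mpi_of_gt hξ h']
      linarith [mpiAux_nonneg hξ hadm x z, mpiAux_nonneg hξ hadm z y,
        le_max_left (mpiAux v ξ x z) (mpiAux v ξ z y),
        le_max_right (mpiAux v ξ x z) (mpiAux v ξ z y)]
    · rw [mpi_of_lt h, mpi_of_lt h', mpiAux_eq_max hξ hadm hxy h', h0,
        max_eq_right (mpiAux_nonneg hξ hadm y z)]
  rw [vpi, vpi, key]

theorem rlr_sub_rlr {v : A → A → ℝ} {ξ : A → A → Prop} {x y : A} (hxy : x ≠ y) :
    rlr v ξ y - rlr v ξ x = vpi v ξ x y - vpi v ξ y x +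
      ∑ z ∈ (Finset.univ.erase x).erase y, (vpi v ξ x z - vpi v ξ y z) := by
  have hx := Finset.add_sum_erase (Finset.univ.erase x) (vpi v ξ x)
    (Finset.mem_erase.2 ⟨hxy.symm, Finset.mem_univ y⟩)
  have hy := Finset.add_sum_erase (Finset.univ.erase y) (vpi v ξ y)
    (Finset.mem_erase.2 ⟨hxy, Finset.mem_univ x⟩)
  rw [Finset.erase_right_comm] at hy
  rw [Finset.sum_sub_distrib, rlr, rlr]
  linarith

theorem mpiAux_le_rlr_sub_rlr {v : A → A → ℝ} {ξ : A → A → Prop} (hξ : StrictTotal ξ)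
    (hadm : Adm v ξ) {x y : A} (hxy : ξ x y) :
    mpiAux v ξ x y ≤ rlr v ξ y - rlr v ξ x := by
  rw [rlr_sub_rlr (hξ.ne hxy), vpi_sub_vpi_swap hξ hxy, le_add_iff_nonneg_right]
  refine Finset.sum_nonneg fun z hz => sub_nonneg.2 ?_
  simp only [Finset.mem_erase, Finset.mem_univ, and_true] at hz
  exact vpi_le_vpi hξ hadm hxy hz.2 hz.1

theorem rlr_eq_of_mpiAux_eq_zero {v : A → A → ℝ} {ξ : A → A → Prop} (hξ : StrictTotal ξ)
    (hadm : Adm v ξ) {x y : A} (hxy : ξ x y) (h0 : mpiAux v ξ x y = 0) :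
    rlr v ξ x = rlr v ξ y := by
  refine (sub_eq_zero.1 ?_).symm
  rw [rlr_sub_rlr (hξ.ne hxy), vpi_sub_vpi_swap hξ hxy, h0, zero_add]
  refine Finset.sum_eq_zero fun z hz => sub_eq_zero.2 ?_
  simp only [Finset.mem_erase, Finset.mem_univ, and_true] at hz
  exact (vpi_eq_vpi hξ hadm hxy h0 hz.2 hz.1).symm

/-- For a complete Llull matrix with projected scores `v^π` and
rank-like rates `R`: (a) `x ≺ y` in an admissible order implies `R_x ≤ R_y`;
(b) `R_x = R_y ↔ v^π_{xy} = v^π_{yx}`; (c) `R_x < R_y ↔ v^π_{xy} > v^π_{yx}`;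
(d) `v^π_{xy} > v^π_{yx}` implies `x ≺ y` in every admissible order. -/
theorem stmt9 {A : Type*} [Fintype A] [DecidableEq A] (v : A → A → ℝ)
    (hv : Llull v) (ξ : A → A → Prop) (hξ : StrictTotal ξ) (hadm : Adm v ξ) :
    (∀ x y, ξ x y → rlr v ξ x ≤ rlr v ξ y) ∧
    (∀ x y : A, x ≠ y → (rlr v ξ x = rlr v ξ y ↔ vpi v ξ x y = vpi v ξ y x)) ∧
    (∀ x y : A, x ≠ y → (rlr v ξ x < rlr v ξ y ↔ vpi v ξ x y > vpi v ξ y x)) ∧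
    (∀ x y : A, x ≠ y → vpi v ξ x y > vpi v ξ y x →
      ∀ η : A → A → Prop, StrictTotal η → Adm v η → η x y) := by
  have hle : ∀ x y, ξ x y → rlr v ξ x ≤ rlr v ξ y := fun x y h => by
    linarith [mpiAux_le_rlr_sub_rlr hξ hadm h, mpiAux_nonneg hξ hadm x y]
  have heq : ∀ x y, ξ x y → (rlr v ξ x = rlr v ξ y ↔ vpi v ξ x y = vpi v ξ y x) :=
    fun x y h => by
      have h1 := mpiAux_le_rlr_sub_rlr hξ hadm h
      have h2 := mpiAux_nonneg hξ hadm x y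
      have h3 := vpi_sub_vpi_swap (v := v) hξ h
      exact ⟨fun e => by linarith,
        fun e => rlr_eq_of_mpiAux_eq_zero hξ hadm h (by linarith)⟩
  have heq' : ∀ x y, x ≠ y → (rlr v ξ x = rlr v ξ y ↔ vpi v ξ x y = vpi v ξ y x) :=
    fun x y hne => (hξ.2.2 x y hne).elim (heq x y)
      fun h => eq_comm.trans ((heq y x h).trans eq_comm)
  have hlt : ∀ x y, x ≠ y → vpi v ξ y x < vpi v ξ x y → ξ x y := fun x y hne h => by
    refine (hξ.2.2 x y hne).resolve_right fun h' => ?_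
    linarith [vpi_sub_vpi_swap (v := v) hξ h', mpiAux_nonneg hξ hadm y x]
  refine ⟨hle, heq', fun x y hne => ⟨fun h => ?_, fun h => ?_⟩, fun x y hne h η _ hη => ?_⟩
  · have hxy : ξ x y := (hξ.2.2 x y hne).resolve_right fun h' => h.not_ge (hle y x h')
    have hvne : vpi v ξ x y ≠ vpi v ξ y x := fun e => h.ne ((heq' x y hne).2 e)
    refine lt_of_le_of_ne ?_ hvne.symm
    linarith [vpi_sub_vpi_swap (v := v) hξ hxy, mpiAux_nonneg hξ hadm x y]
  · have hxy := hlt x y hne h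
    exact lt_of_le_of_ne (hle x y hxy) fun e => h.ne ((heq' x y hne).1 e).symm
  · refine hη x y (istar_lt_of_mpiAux_pos hξ (ξ := ξ) ?_)
    linarith [vpi_sub_vpi_swap (v := v) hξ (hlt x y hne h)]
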